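/- arXiv:2111.00370 — 2 statements merged into one kernel-verified Lean document; each statement's English description precedes it below -/
import Mathlib

section
/- Suppose (H, p, D, U) and (H', p', D', U') are oriented quantum algebras, (H, H', p, p', r, D, U, D', U') and (H, H', p, p', q, D, U, D', U') are OQA nonuples, and the compatibility conditions Q^t p'ⱼ ⊗ Q_t r_k ⊗ p'ʲ r^k = p'ⱼ Q^t ⊗ r_k Q_t ⊗ r^k p'ʲ and r_k pᵢ ⊗ r^k Q^t ⊗ pⁱ Q_t = pᵢ r_k ⊗ Q^t r^k ⊗ Q_t pⁱ hold, where Q = q⁻¹ = Q_t ⊗ Q^t. Then (H ⊗ H', α̃, D ⊗ D', U ⊗ U') is an oriented quantum algebra with α̃ = (r_k pᵢ ⊗ p'ⱼ Q^t) ⊗ (pⁱ Q_t ⊗ r^k p'ʲ) ∈ (H ⊗ H') ⊗ (H ⊗ H'). -/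
open TensorProduct

noncomputable section

namespace OQApaper

variable (K : Type*) [Field K]

section Maps

variable (A B C D : Type*) [Ring A] [Ring B] [Ring C] [Ring D]
  [Algebra K A] [Algebra K B] [Algebra K C] [Algebra K D]

/-- The linear embedding `A ⊗ B → A ⊗ Bᵐᵒᵖ` (identity on the first factor, `op` on the
second), used to phrase statements about products in `H ⊗ H'^op`. -/
def opify : A ⊗[K] B →ₗ[K] A ⊗[K] Bᵐᵒᵖ :=
  TensorProduct.map LinearMap.id (MulOpposite.opLinearEquiv K).toLinearMap

/-- `a ⊗ b ↦ a ⊗ b ⊗ 1` into `A ⊗ (B ⊗ C)`. -/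
def emb12 : A ⊗[K] B →ₐ[K] A ⊗[K] (B ⊗[K] C) :=
  Algebra.TensorProduct.map (AlgHom.id K A) Algebra.TensorProduct.includeLeft

/-- `a ⊗ c ↦ a ⊗ 1 ⊗ c` into `A ⊗ (B ⊗ C)`. -/
def emb13 : A ⊗[K] C →ₐ[K] A ⊗[K] (B ⊗[K] C) :=
  Algebra.TensorProduct.map (AlgHom.id K A) Algebra.TensorProduct.includeRight

/-- `b ⊗ c ↦ 1 ⊗ b ⊗ c` into `A ⊗ (B ⊗ C)`. -/
def emb23 : B ⊗[K] C →ₐ[K] A ⊗[K] (B ⊗[K] C) :=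
  Algebra.TensorProduct.includeRight

/-- `b ⊗ a ↦ a ⊗ b ⊗ 1` into `A ⊗ (B ⊗ C)` (swapped version of `emb12`). -/
def emb21 : B ⊗[K] A →ₐ[K] A ⊗[K] (B ⊗[K] C) :=
  (emb12 K A B C).comp (Algebra.TensorProduct.comm K B A).toAlgHom

/-- `c ⊗ b ↦ 1 ⊗ b ⊗ c` into `A ⊗ (B ⊗ C)` (swapped version of `emb23`). -/
def emb32 : C ⊗[K] B →ₐ[K] A ⊗[K] (B ⊗[K] C) :=
  (emb23 K A B C).comp (Algebra.TensorProduct.comm K C B).toAlgHom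

/-- `a ⊗ c ↦ (a ⊗ 1) ⊗ (c ⊗ 1)` into `(A ⊗ B) ⊗ (C ⊗ D)`. -/
def E13 : A ⊗[K] C →ₐ[K] (A ⊗[K] B) ⊗[K] (C ⊗[K] D) :=
  Algebra.TensorProduct.map Algebra.TensorProduct.includeLeft
    Algebra.TensorProduct.includeLeft

/-- `a ⊗ d ↦ (a ⊗ 1) ⊗ (1 ⊗ d)` into `(A ⊗ B) ⊗ (C ⊗ D)`. -/
def E14 : A ⊗[K] D →ₐ[K] (A ⊗[K] B) ⊗[K] (C ⊗[K] D) :=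
  Algebra.TensorProduct.map Algebra.TensorProduct.includeLeft
    Algebra.TensorProduct.includeRight

/-- `b ⊗ d ↦ (1 ⊗ b) ⊗ (1 ⊗ d)` into `(A ⊗ B) ⊗ (C ⊗ D)`. -/
def E24 : B ⊗[K] D →ₐ[K] (A ⊗[K] B) ⊗[K] (C ⊗[K] D) :=
  Algebra.TensorProduct.map Algebra.TensorProduct.includeRight
    Algebra.TensorProduct.includeRight

/-- `b ⊗ c ↦ (1 ⊗ b) ⊗ (c ⊗ 1)` into `(A ⊗ B) ⊗ (C ⊗ D)`. -/
def E23 : B ⊗[K] C →ₐ[K] (A ⊗[K] B) ⊗[K] (C ⊗[K] D) :=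
  Algebra.TensorProduct.map Algebra.TensorProduct.includeRight
    Algebra.TensorProduct.includeLeft

/-- `c ⊗ b ↦ (1 ⊗ b) ⊗ (c ⊗ 1)` into `(A ⊗ B) ⊗ (C ⊗ D)` (swapped `E23`). -/
def E32 : C ⊗[K] B →ₐ[K] (A ⊗[K] B) ⊗[K] (C ⊗[K] D) :=
  (E23 K A B C D).comp (Algebra.TensorProduct.comm K C B).toAlgHom

end Maps

section Defs

variable {A B : Type*} [Ring A] [Ring B] [Algebra K A] [Algebra K B]

/-- An oriented quantum algebra `(A, r, σ, τ)` (Definition 1.1), with the inverse `ri`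
of `r` given explicitly:  `σ, τ` are commuting algebra automorphisms, `(σ ⊗ id)(r⁻¹)`
and `(id ⊗ τ)(r)` are inverses in `A ⊗ Aᵐᵒᵖ`, `(σ ⊗ σ)(r) = r = (τ ⊗ τ)(r)`, and `r`
satisfies the quantum Yang–Baxter equation. -/
structure IsOQA (r ri : A ⊗[K] A) (σ τ : A ≃ₐ[K] A) : Prop where
  comm_auto : ∀ a : A, σ (τ a) = τ (σ a)
  mul_inv : r * ri = 1
  inv_mul : ri * r = 1
  op_mul_inv :
    opify K A A (Algebra.TensorProduct.map σ.toAlgHom (AlgHom.id K A) ri) *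
      opify K A A (Algebra.TensorProduct.map (AlgHom.id K A) τ.toAlgHom r) = 1
  op_inv_mul :
    opify K A A (Algebra.TensorProduct.map (AlgHom.id K A) τ.toAlgHom r) *
      opify K A A (Algebra.TensorProduct.map σ.toAlgHom (AlgHom.id K A) ri) = 1
  map_sigma : Algebra.TensorProduct.map σ.toAlgHom σ.toAlgHom r = r
  map_tau : Algebra.TensorProduct.map τ.toAlgHom τ.toAlgHom r = r
  qybe : emb12 K A A A r * emb13 K A A A r * emb23 K A A A r =
    emb23 K A A A r * emb13 K A A A r * emb12 K A A A r

/-- An OQA nonuple `(A, B, p, p', r, σ, τ, σ', τ')` (Definition 3.1), with explicit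
inverses `pinv, p'inv, rinv`. -/
structure IsOQANonuple (p pinv : A ⊗[K] A) (p' p'inv : B ⊗[K] B) (r rinv : A ⊗[K] B)
    (σ τ : A ≃ₐ[K] A) (σ' τ' : B ≃ₐ[K] B) : Prop where
  comm_auto : ∀ a : A, σ (τ a) = τ (σ a)
  comm_auto' : ∀ b : B, σ' (τ' b) = τ' (σ' b)
  p_mul_inv : p * pinv = 1
  p_inv_mul : pinv * p = 1
  p'_mul_inv : p' * p'inv = 1
  p'_inv_mul : p'inv * p' = 1
  r_mul_inv : r * rinv = 1
  r_inv_mul : rinv * r = 1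
  op_mul_inv :
    opify K A B (Algebra.TensorProduct.map σ.toAlgHom (AlgHom.id K B) rinv) *
      opify K A B (Algebra.TensorProduct.map (AlgHom.id K A) τ'.toAlgHom r) = 1
  op_inv_mul :
    opify K A B (Algebra.TensorProduct.map (AlgHom.id K A) τ'.toAlgHom r) *
      opify K A B (Algebra.TensorProduct.map σ.toAlgHom (AlgHom.id K B) rinv) = 1
  map_sigma : Algebra.TensorProduct.map σ.toAlgHom σ'.toAlgHom r = r
  map_tau : Algebra.TensorProduct.map τ.toAlgHom τ'.toAlgHom r = r
  cond3 : emb12 K A A B p * emb13 K A A B r * emb23 K A A B r =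
    emb23 K A A B r * emb13 K A A B r * emb12 K A A B p
  cond4 : emb12 K A B B r * emb13 K A B B r * emb23 K A B B p' =
    emb23 K A B B p' * emb13 K A B B r * emb12 K A B B r

end Defs

section BialgDefs

variable {A B : Type*} [Ring A] [Ring B] [Bialgebra K A] [Bialgebra K B]

/-- A weak R-matrix of `(A, B)` (Definition 2.6):  an invertible `r ∈ A ⊗ B` with
`(Δ ⊗ id)(r) = r₁₃ r₂₃` and `(id ⊗ Δ)(r) = r₁₃ r₁₂`. -/
structure IsWeakR (r : A ⊗[K] B) : Prop where
  isUnit : IsUnit r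
  comul_left :
    TensorProduct.assoc K A A B
        (TensorProduct.map (Coalgebra.comul (R := K)) LinearMap.id r) =
      emb13 K A A B r * emb23 K A A B r
  comul_right :
    TensorProduct.map LinearMap.id (Coalgebra.comul (R := K)) r =
      emb13 K A B B r * emb12 K A B B r

/-- A quasitriangular structure `p` on a bialgebra `A` (Definition 2.4). -/
structure IsQT (p : A ⊗[K] A) : Prop where
  comul_left :
    TensorProduct.assoc K A A A
        (TensorProduct.map (Coalgebra.comul (R := K)) LinearMap.id p) =
      emb13 K A A A p * emb23 K A A A p
  comul_right :
    TensorProduct.map LinearMap.id (Coalgebra.comul (R := K)) p =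
      emb13 K A A A p * emb12 K A A A p
  almost_cocomm : ∀ h : A,
    TensorProduct.comm K A A (Coalgebra.comul (R := K) h) * p =
      p * Coalgebra.comul (R := K) h
  counit_left :
    TensorProduct.lid K A
      (TensorProduct.map (Coalgebra.counit (R := K)) LinearMap.id p) = 1
  counit_right :
    TensorProduct.rid K A
      (TensorProduct.map LinearMap.id (Coalgebra.counit (R := K)) p) = 1

end BialgDefs

end OQApaper

open OQApaper

/-- The linear map `x ⊗ y ↦ f x * g y`. -/
def mulPair {K X Y W : Type*} [Field K] [Ring X] [Ring Y] [Ring W] [Algebra K X] [Algebra K Y]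
    [Algebra K W] (f : X →ₐ[K] W) (g : Y →ₐ[K] W) : X ⊗[K] Y →ₗ[K] W :=
  LinearMap.mul' K W ∘ₗ TensorProduct.map f.toLinearMap g.toLinearMap

section MulPair

variable {K X Y Z V W : Type*} [Field K] [Ring X] [Ring Y] [Ring Z] [Ring V] [Ring W]
  [Algebra K X] [Algebra K Y] [Algebra K Z] [Algebra K V] [Algebra K W]

@[simp]
lemma mulPair_tmul (f : X →ₐ[K] W) (g : Y →ₐ[K] W) (x : X) (y : Y) :
    mulPair f g (x ⊗ₜ[K] y) = f x * g y := by
  simp [mulPair]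

lemma mulPair_eq_lift (f : X →ₐ[K] W) (g : Y →ₐ[K] W) (h : ∀ x y, Commute (f x) (g y))
    (t : X ⊗[K] Y) : mulPair f g t = Algebra.TensorProduct.lift f g h t := by
  induction t with
  | zero => simp
  | tmul x y => simp
  | add a b ha hb => rw [map_add, map_add, ha, hb]

lemma commute_mulPair_right (w : W) (f : X →ₐ[K] W) (g : Y →ₐ[K] W)
    (hf : ∀ x, Commute w (f x)) (hg : ∀ y, Commute w (g y)) (t : X ⊗[K] Y) :
    Commute w (mulPair f g t) := by
  induction t with
  | zero => simp
  | tmul x y => rw [mulPair_tmul]; exact (hf x).mul_right (hg y)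
  | add a b ha hb => rw [map_add]; exact ha.add_right hb

lemma commute_mulPair (f : X →ₐ[K] W) (g : Y →ₐ[K] W) (h : Z →ₐ[K] W) (k : V →ₐ[K] W)
    (hfh : ∀ x z, Commute (f x) (h z)) (hfk : ∀ x z, Commute (f x) (k z))
    (hgh : ∀ x z, Commute (g x) (h z)) (hgk : ∀ x z, Commute (g x) (k z))
    (s : X ⊗[K] Y) (t : Z ⊗[K] V) : Commute (mulPair f g s) (mulPair h k t) := by
  refine commute_mulPair_right _ h k (fun z => ?_) (fun v => ?_) t
  · exact (commute_mulPair_right _ f g (fun x => (hfh x z).symm) (fun y => (hgh y z).symm) s).symm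
  · exact (commute_mulPair_right _ f g (fun x => (hfk x v).symm) (fun y => (hgk y v).symm) s).symm

lemma mulPair_mul_eq_one (f : X →ₐ[K] W) (g : Y →ₐ[K] W) (h : ∀ x y, Commute (f x) (g y))
    {s t : X ⊗[K] Y} (hst : s * t = 1) : mulPair f g s * mulPair f g t = 1 := by
  rw [mulPair_eq_lift f g h, mulPair_eq_lift f g h, ← map_mul, hst, map_one]

/-- The algebra map out of a triple tensor product induced by pairwise commuting maps. -/
def lift₃ (f : X →ₐ[K] W) (g : Y →ₐ[K] W) (h : Z →ₐ[K] W)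
    (hfg : ∀ x y, Commute (f x) (g y)) (hfh : ∀ x y, Commute (f x) (h y))
    (hgh : ∀ x y, Commute (g x) (h y)) : X ⊗[K] (Y ⊗[K] Z) →ₐ[K] W :=
  Algebra.TensorProduct.lift f (Algebra.TensorProduct.lift g h hgh) fun x t => by
    rw [← mulPair_eq_lift]
    exact commute_mulPair_right _ g h (hfg x) (hfh x) t

variable (f : X →ₐ[K] W) (g : Y →ₐ[K] W) (h : Z →ₐ[K] W)
  (hfg : ∀ x y, Commute (f x) (g y)) (hfh : ∀ x y, Commute (f x) (h y))
  (hgh : ∀ x y, Commute (g x) (h y))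

lemma lift₃_emb12 (t : X ⊗[K] Y) :
    lift₃ f g h hfg hfh hgh (emb12 K X Y Z t) = mulPair f g t := by
  induction t with
  | zero => simp
  | tmul x y => simp [lift₃, emb12]
  | add a b ha hb => rw [map_add, map_add, map_add, ha, hb]

lemma lift₃_emb13 (t : X ⊗[K] Z) :
    lift₃ f g h hfg hfh hgh (emb13 K X Y Z t) = mulPair f h t := by
  induction t with
  | zero => simp
  | tmul x y => simp [lift₃, emb13]
  | add a b ha hb => rw [map_add, map_add, map_add, ha, hb]

lemma lift₃_emb23 (t : Y ⊗[K] Z) :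
    lift₃ f g h hfg hfh hgh (emb23 K X Y Z t) = mulPair g h t := by
  induction t with
  | zero => simp
  | tmul x y => simp [lift₃, emb23]
  | add a b ha hb => rw [map_add, map_add, map_add, ha, hb]

lemma lift₃_emb21 (t : Y ⊗[K] X) :
    lift₃ f g h hfg hfh hgh (emb21 K X Y Z t) = mulPair g f t := by
  induction t with
  | zero => simp
  | tmul x y => simp [lift₃, emb21, emb12, (hfg _ _).eq]
  | add a b ha hb => rw [map_add, map_add, map_add, ha, hb]

lemma lift₃_emb32 (t : Z ⊗[K] Y) :
    lift₃ f g h hfg hfh hgh (emb32 K X Y Z t) = mulPair h g t := by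
  induction t with
  | zero => simp
  | tmul x y => simp [lift₃, emb32, emb23, (hgh _ _).eq]
  | add a b ha hb => rw [map_add, map_add, map_add, ha, hb]

end MulPair

section Monoid

variable {M : Type*} [Monoid M]

lemma mul_mul_inv_swap {a a' b b' p : M} (ha : a * a' = 1) (ha' : a' * a = 1) (hb : b * b' = 1)
    (hb' : b' * b = 1) (h : p * a * b = b * a * p) : a' * b' * p = p * b' * a' :=
  calc a' * b' * p = a' * b' * (p * a * b) * b' * a' := by
        simp only [mul_assoc]
        rw [← mul_assoc b b', hb, one_mul, ha, mul_one]
    _ = p * b' * a' := by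
        rw [h]
        simp only [mul_assoc]
        rw [← mul_assoc b' b, hb', one_mul, ← mul_assoc a' a, ha', one_mul]

lemma mul_eq_one_of_four {a b c d a' b' c' d' : M} (hd : d * d' = 1) (hc : c * c' = 1)
    (hb : b * b' = 1) (ha : a * a' = 1) (hbc : Commute b' c') :
    a * b * c * d * (d' * b' * c' * a') = 1 := by
  rw [hbc.right_comm d']
  simp only [mul_assoc]
  rw [← mul_assoc d d', hd, one_mul, ← mul_assoc c c', hc, one_mul, ← mul_assoc b b', hb, one_mul,
    ha]

lemma reassoc₃ {a b c d e f : M} (h : a * b * c = d * e * f) (z : M) :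
    a * (b * (c * z)) = d * (e * (f * z)) := by
  simpa only [mul_assoc] using congrArg (· * z) h

/-- The word identity in a monoid behind the quantum Yang–Baxter equation for the product. -/
lemma yangBaxter_of_relations {r14 r16 r36 p13 p15 p35 s24 s26 s46 t32 t52 t54 : M}
    (hp : p13 * p15 * p35 = p35 * p15 * p13) (hs : s24 * s26 * s46 = s46 * s26 * s24)
    (hpr : p13 * r16 * r36 = r36 * r16 * p13) (hrs : r14 * r16 * s46 = s46 * r16 * r14)
    (hpt : t32 * t52 * p35 = p35 * t52 * t32) (hst : t54 * t52 * s24 = s24 * t52 * t54)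
    (htsr : t32 * s26 * r36 = r36 * s26 * t32) (hrpt : r14 * p15 * t54 = t54 * p15 * r14)
    (c1 : Commute t32 r16) (c2 : Commute t32 p15) (c3 : Commute t52 r36) (c4 : Commute s24 r16)
    (c5 : Commute s24 p15) (c6 : Commute s24 r36) (c7 : Commute r36 p15) (c8 : Commute r14 r36)
    (c9 : Commute s24 p35) (c10 : Commute s26 p35) (c11 : Commute t32 s46)
    (c12 : Commute t52 s46) (c13 : Commute t32 t54) (c14 : Commute p13 s46)
    (c15 : Commute p15 s46) (c16 : Commute p35 s46) (c17 : Commute p35 r14)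
    (c18 : Commute p35 r16) (c19 : Commute s26 t54) (c20 : Commute p13 t54)
    (c21 : Commute r16 t54) (c22 : Commute r14 s26) (c23 : Commute r14 t52)
    (c24 : Commute p13 s26) (c25 : Commute p13 t52) :
    (r14 * p13 * s24 * t32) * (r16 * p15 * s26 * t52) * (r36 * p35 * s46 * t54) =
      (r36 * p35 * s46 * t54) * (r16 * p15 * s26 * t52) * (r14 * p13 * s24 * t32) := by
  simp only [mul_assoc]
  calc r14 * (p13 * (s24 * (t32 * (r16 * (p15 * (s26 * (t52 * (r36 * (p35 * (s46 * t54))))))))))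
      = r14 * (p13 * (s24 * (r16 * (p15 * (r36 * (s26 * (t32 * (t52 * (p35 * (s46 * t54)))))))))) := by
        rw [c1.left_comm, c2.left_comm, c3.left_comm, reassoc₃ htsr]
    _ = r14 * (r36 * (r16 * (p13 * (p15 * (p35 * (s24 * (s26 * (s46 * (t52 * (t32 * t54)))))))))) := by
        rw [c4.left_comm, c5.left_comm, c6.left_comm, ← c7.left_comm, reassoc₃ hpr, reassoc₃ hpt,
          c10.left_comm, c9.left_comm, c11.left_comm, c12.left_comm]
    _ = r36 * (s46 * (r16 * (r14 * (p35 * (p15 * (p13 * (s26 * (s24 * (t52 * (t54 * t32)))))))))) := by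
        rw [reassoc₃ hp, reassoc₃ hs, c13.eq, c14.left_comm, c15.left_comm, c16.left_comm,
          c8.left_comm, reassoc₃ hrs]
    _ = r36 * (p35 * (s46 * (r16 * (t54 * (p15 * (r14 * (p13 * (s26 * (t52 * (s24 * t32)))))))))) := by
        rw [← reassoc₃ hst, c19.left_comm, c20.left_comm, ← c17.left_comm, ← c18.left_comm,
          ← c16.left_comm, reassoc₃ hrpt]
    _ = _ := by
        rw [c21.left_comm, c24.left_comm, c25.left_comm, c22.left_comm, c23.left_comm]

end Monoid

section Opposite

variable {K A B : Type*} [Field K] [Ring A] [Ring B] [Algebra K A] [Algebra K B]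

/-- The inclusion of `A` as the first factor of `(A ⊗ B) ⊗ (A ⊗ B)ᵐᵒᵖ`. -/
def opIncl₁ (K A B : Type*) [Field K] [Ring A] [Ring B] [Algebra K A] [Algebra K B] :
    A →ₐ[K] (A ⊗[K] B) ⊗[K] (A ⊗[K] B)ᵐᵒᵖ :=
  Algebra.TensorProduct.includeLeft.comp Algebra.TensorProduct.includeLeft

/-- The inclusion of `B` as the second factor of `(A ⊗ B) ⊗ (A ⊗ B)ᵐᵒᵖ`. -/
def opIncl₂ (K A B : Type*) [Field K] [Ring A] [Ring B] [Algebra K A] [Algebra K B] :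
    B →ₐ[K] (A ⊗[K] B) ⊗[K] (A ⊗[K] B)ᵐᵒᵖ :=
  Algebra.TensorProduct.includeLeft.comp Algebra.TensorProduct.includeRight

/-- The inclusion of `Aᵐᵒᵖ` as the third factor of `(A ⊗ B) ⊗ (A ⊗ B)ᵐᵒᵖ`. -/
def opIncl₃ (K A B : Type*) [Field K] [Ring A] [Ring B] [Algebra K A] [Algebra K B] :
    Aᵐᵒᵖ →ₐ[K] (A ⊗[K] B) ⊗[K] (A ⊗[K] B)ᵐᵒᵖ :=
  Algebra.TensorProduct.includeRight.comp (AlgHom.op Algebra.TensorProduct.includeLeft)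

/-- The inclusion of `Bᵐᵒᵖ` as the fourth factor of `(A ⊗ B) ⊗ (A ⊗ B)ᵐᵒᵖ`. -/
def opIncl₄ (K A B : Type*) [Field K] [Ring A] [Ring B] [Algebra K A] [Algebra K B] :
    Bᵐᵒᵖ →ₐ[K] (A ⊗[K] B) ⊗[K] (A ⊗[K] B)ᵐᵒᵖ :=
  Algebra.TensorProduct.includeRight.comp (AlgHom.op Algebra.TensorProduct.includeRight)

lemma opIncl₁_apply (a : A) : opIncl₁ K A B a = (a ⊗ₜ 1) ⊗ₜ 1 := rfl

lemma opIncl₂_apply (b : B) : opIncl₂ K A B b = (1 ⊗ₜ b) ⊗ₜ 1 := rfl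

lemma opIncl₃_apply (a : Aᵐᵒᵖ) : opIncl₃ K A B a = 1 ⊗ₜ .op (a.unop ⊗ₜ 1) := rfl

lemma opIncl₄_apply (b : Bᵐᵒᵖ) : opIncl₄ K A B b = 1 ⊗ₜ .op (1 ⊗ₜ b.unop) := rfl

lemma opify_tmul (a : A) (b : B) : opify K A B (a ⊗ₜ b) = a ⊗ₜ .op b := rfl

lemma opify_product (s w : A ⊗[K] B) (u : A ⊗[K] A) (v : B ⊗[K] B) :
    opify K (A ⊗[K] B) (A ⊗[K] B)
        (E14 K A B A B s * E13 K A B A B u * E24 K A B A B v * E32 K A B A B w) =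
      mulPair (opIncl₂ K A B) (opIncl₄ K A B) (opify K B B v) *
        mulPair (opIncl₁ K A B) (opIncl₄ K A B) (opify K A B s) *
        mulPair (opIncl₂ K A B) (opIncl₃ K A B)
          (opify K B A (Algebra.TensorProduct.comm K A B w)) *
        mulPair (opIncl₁ K A B) (opIncl₃ K A B) (opify K A A u) := by
  induction s with
  | zero => simp
  | add a b ha hb => simp only [map_add, add_mul, mul_add, ha, hb]
  | tmul s₁ s₂ =>
  induction u with
  | zero => simp
  | add a b ha hb => simp only [map_add, add_mul, mul_add, ha, hb]
  | tmul u₁ u₂ =>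
  induction v with
  | zero => simp
  | add a b ha hb => simp only [map_add, add_mul, mul_add, ha, hb]
  | tmul v₁ v₂ =>
  induction w with
  | zero => simp
  | add a b ha hb => simp only [map_add, add_mul, mul_add, ha, hb]
  | tmul w₁ w₂ =>
  simp [E14, E13, E24, E32, E23, opify_tmul, opIncl₁_apply, opIncl₂_apply, opIncl₃_apply,
    opIncl₄_apply, ← MulOpposite.op_mul]

lemma opify_product_inv (s w : A ⊗[K] B) (u : A ⊗[K] A) (v : B ⊗[K] B) :
    opify K (A ⊗[K] B) (A ⊗[K] B)
        (E32 K A B A B w * E13 K A B A B u * E24 K A B A B v * E14 K A B A B s) =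
      mulPair (opIncl₁ K A B) (opIncl₃ K A B) (opify K A A u) *
        mulPair (opIncl₁ K A B) (opIncl₄ K A B) (opify K A B s) *
        mulPair (opIncl₂ K A B) (opIncl₃ K A B)
          (opify K B A (Algebra.TensorProduct.comm K A B w)) *
        mulPair (opIncl₂ K A B) (opIncl₄ K A B) (opify K B B v) := by
  induction s with
  | zero => simp
  | add a b ha hb => simp only [map_add, add_mul, mul_add, ha, hb]
  | tmul s₁ s₂ =>
  induction u with
  | zero => simp
  | add a b ha hb => simp only [map_add, add_mul, mul_add, ha, hb]
  | tmul u₁ u₂ =>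
  induction v with
  | zero => simp
  | add a b ha hb => simp only [map_add, add_mul, mul_add, ha, hb]
  | tmul v₁ v₂ =>
  induction w with
  | zero => simp
  | add a b ha hb => simp only [map_add, add_mul, mul_add, ha, hb]
  | tmul w₁ w₂ =>
  simp [E14, E13, E24, E32, E23, opify_tmul, opIncl₁_apply, opIncl₂_apply, opIncl₃_apply,
    opIncl₄_apply, ← MulOpposite.op_mul]

/-- The linear map `a ⊗ b ↦ b ⊗ a` from `A ⊗ Bᵐᵒᵖ` to `B ⊗ Aᵐᵒᵖ`; it reverses products. -/
def opSwap (K A B : Type*) [Field K] [Ring A] [Ring B] [Algebra K A] [Algebra K B] :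
    A ⊗[K] Bᵐᵒᵖ →ₗ[K] B ⊗[K] Aᵐᵒᵖ :=
  TensorProduct.map (MulOpposite.opLinearEquiv K).symm.toLinearMap
    (MulOpposite.opLinearEquiv K).toLinearMap ∘ₗ (TensorProduct.comm K A Bᵐᵒᵖ).toLinearMap

lemma opSwap_tmul (a : A) (b : Bᵐᵒᵖ) : opSwap K A B (a ⊗ₜ b) = b.unop ⊗ₜ .op a := rfl

lemma opSwap_mul (s t : A ⊗[K] Bᵐᵒᵖ) :
    opSwap K A B (s * t) = opSwap K A B t * opSwap K A B s := by
  induction s with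
  | zero => simp
  | add a b ha hb => simp only [map_add, add_mul, mul_add, ha, hb]
  | tmul s₁ s₂ =>
  induction t with
  | zero => simp
  | add a b ha hb => simp only [map_add, add_mul, mul_add, ha, hb]
  | tmul t₁ t₂ => simp [opSwap_tmul]

lemma opSwap_one : opSwap K A B 1 = 1 := rfl

lemma opSwap_opify (t : A ⊗[K] B) :
    opSwap K A B (opify K A B t) = opify K B A (Algebra.TensorProduct.comm K A B t) := by
  induction t with
  | zero => simp
  | add a b ha hb => simp only [map_add, ha, hb]
  | tmul a b => rfl

lemma map_opify (f : A ≃ₐ[K] A) (g : B ≃ₐ[K] B) (t : A ⊗[K] B) :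
    Algebra.TensorProduct.map f.toAlgHom (AlgHom.op g.toAlgHom) (opify K A B t) =
      opify K A B (Algebra.TensorProduct.map f.toAlgHom g.toAlgHom t) := by
  induction t with
  | zero => simp
  | add a b ha hb => simp only [map_add, ha, hb]
  | tmul a b => rfl

lemma map_eq_self_of_mul_eq_one {R : Type*} [Ring R] [Algebra K R] (φ : R →ₐ[K] R) {x y : R}
    (hxy : x * y = 1) (hyx : y * x = 1) (hx : φ x = x) : φ y = y :=
  left_inv_eq_right_inv (by rw [← hx, ← map_mul, hyx, map_one]) hxy

lemma opify_map_swap {σ τ : A ≃ₐ[K] A} {σ' τ' : B ≃ₐ[K] B} {q qinv : A ⊗[K] B}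
    (hσ : Algebra.TensorProduct.map σ.toAlgHom σ'.toAlgHom q = q)
    (hτ : Algebra.TensorProduct.map τ.toAlgHom τ'.toAlgHom qinv = qinv) :
    opify K B A (Algebra.TensorProduct.comm K A B
        (Algebra.TensorProduct.map τ.toAlgHom (AlgHom.id K B) qinv)) =
      opSwap K A B (Algebra.TensorProduct.map σ.symm.toAlgHom (AlgHom.op τ'.symm.toAlgHom)
        (opify K A B (Algebra.TensorProduct.map σ.toAlgHom (AlgHom.id K B) qinv))) ∧
    opify K B A (Algebra.TensorProduct.comm K A B
        (Algebra.TensorProduct.map (AlgHom.id K A) σ'.toAlgHom q)) =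
      opSwap K A B (Algebra.TensorProduct.map σ.symm.toAlgHom (AlgHom.op τ'.symm.toAlgHom)
        (opify K A B (Algebra.TensorProduct.map (AlgHom.id K A) τ'.toAlgHom q))) := by
  rw [map_opify, map_opify, opSwap_opify, opSwap_opify]
  constructor
  · conv_rhs => rw [← hτ]
    congr 2
    simp only [← AlgHom.comp_apply]
    congr 1
    ext a <;> simp
  · conv_rhs => rw [← hσ]
    congr 2
    simp only [← AlgHom.comp_apply]
    congr 1
    ext a <;> simp

end Opposite

section Product

variable {K A B W : Type*} [Field K] [Ring A] [Ring B] [Ring W] [Algebra K A] [Algebra K B]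
  [Algebra K W]

lemma commute_E13_E24 (u : A ⊗[K] A) (v : B ⊗[K] B) :
    Commute (E13 K A B A B u) (E24 K A B A B v) := by
  induction u with
  | zero => simp
  | add a b ha hb => rw [map_add]; exact ha.add_left hb
  | tmul u₁ u₂ =>
  induction v with
  | zero => simp
  | add a b ha hb => rw [map_add]; exact ha.add_right hb
  | tmul v₁ v₂ => simp [Commute, SemiconjBy, E13, E24]

lemma map_map_E13 (f₁ f₃ : A →ₐ[K] A) (f₂ f₄ : B →ₐ[K] B) (t : A ⊗[K] A) :
    Algebra.TensorProduct.map (Algebra.TensorProduct.map f₁ f₂) (Algebra.TensorProduct.map f₃ f₄)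
      (E13 K A B A B t) = E13 K A B A B (Algebra.TensorProduct.map f₁ f₃ t) := by
  induction t with
  | zero => simp
  | add a b ha hb => simp only [map_add, ha, hb]
  | tmul a b => simp [E13]

lemma map_map_E14 (f₁ f₃ : A →ₐ[K] A) (f₂ f₄ : B →ₐ[K] B) (t : A ⊗[K] B) :
    Algebra.TensorProduct.map (Algebra.TensorProduct.map f₁ f₂) (Algebra.TensorProduct.map f₃ f₄)
      (E14 K A B A B t) = E14 K A B A B (Algebra.TensorProduct.map f₁ f₄ t) := by
  induction t with
  | zero => simp
  | add a b ha hb => simp only [map_add, ha, hb]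
  | tmul a b => simp [E14]

lemma map_map_E24 (f₁ f₃ : A →ₐ[K] A) (f₂ f₄ : B →ₐ[K] B) (t : B ⊗[K] B) :
    Algebra.TensorProduct.map (Algebra.TensorProduct.map f₁ f₂) (Algebra.TensorProduct.map f₃ f₄)
      (E24 K A B A B t) = E24 K A B A B (Algebra.TensorProduct.map f₂ f₄ t) := by
  induction t with
  | zero => simp
  | add a b ha hb => simp only [map_add, ha, hb]
  | tmul a b => simp [E24]

lemma map_map_E32 (f₁ f₃ : A →ₐ[K] A) (f₂ f₄ : B →ₐ[K] B) (t : A ⊗[K] B) :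
    Algebra.TensorProduct.map (Algebra.TensorProduct.map f₁ f₂) (Algebra.TensorProduct.map f₃ f₄)
      (E32 K A B A B t) = E32 K A B A B (Algebra.TensorProduct.map f₃ f₂ t) := by
  induction t with
  | zero => simp
  | add a b ha hb => simp only [map_add, ha, hb]
  | tmul a b => simp [E32, E23]

lemma map_product (φ : (A ⊗[K] B) ⊗[K] (A ⊗[K] B) →ₐ[K] W)
    {f₁ f₃ : A →ₐ[K] W} {f₂ f₄ : B →ₐ[K] W}
    (h₁ : ∀ a, φ ((a ⊗ₜ 1) ⊗ₜ 1) = f₁ a) (h₂ : ∀ b, φ ((1 ⊗ₜ b) ⊗ₜ 1) = f₂ b)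
    (h₃ : ∀ a, φ (1 ⊗ₜ (a ⊗ₜ 1)) = f₃ a) (h₄ : ∀ b, φ (1 ⊗ₜ (1 ⊗ₜ b)) = f₄ b)
    (s w : A ⊗[K] B) (u : A ⊗[K] A) (v : B ⊗[K] B) :
    φ (E14 K A B A B s * E13 K A B A B u * E24 K A B A B v * E32 K A B A B w) =
      mulPair f₁ f₄ s * mulPair f₁ f₃ u * mulPair f₂ f₄ v * mulPair f₃ f₂ w := by
  simp only [map_mul]
  congr 1
  · congr 1
    · congr 1
      · induction s with
        | zero => simp
        | add a b ha hb => simp only [map_add, ha, hb]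
        | tmul a b => rw [mulPair_tmul, ← h₁, ← h₄, ← map_mul]; simp [E14]
      · induction u with
        | zero => simp
        | add a b ha hb => simp only [map_add, ha, hb]
        | tmul a b => rw [mulPair_tmul, ← h₁, ← h₃, ← map_mul]; simp [E13]
    · induction v with
      | zero => simp
      | add a b ha hb => simp only [map_add, ha, hb]
      | tmul a b => rw [mulPair_tmul, ← h₂, ← h₄, ← map_mul]; simp [E24]
  · induction w with
    | zero => simp
    | add a b ha hb => simp only [map_add, ha, hb]
    | tmul a b => rw [mulPair_tmul, ← h₃, ← h₂, ← map_mul]; simp [E32, E23]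

/-- The three inclusions of `R` into `R ⊗ (R ⊗ R)`. -/
def slot (K R : Type*) [Field K] [Ring R] [Algebra K R] : Fin 3 → R →ₐ[K] R ⊗[K] (R ⊗[K] R) :=
  ![Algebra.TensorProduct.includeLeft,
    Algebra.TensorProduct.includeRight.comp Algebra.TensorProduct.includeLeft,
    Algebra.TensorProduct.includeRight.comp Algebra.TensorProduct.includeRight]

lemma commute_slot {R : Type*} [Ring R] [Algebra K R] {i j : Fin 3} (hij : i ≠ j) (x y : R) :
    Commute (slot K R i x) (slot K R j y) := by
  fin_cases i <;> fin_cases j <;>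
    first
    | exact absurd rfl hij
    | simp [slot, Commute, SemiconjBy, Algebra.TensorProduct.one_def]

/-- The Yang–Baxter equation for the product, for commuting copies of `A` and `B` in an
algebra. -/
lemma yangBaxter_mulPair (a : Fin 3 → A →ₐ[K] W) (b : Fin 3 → B →ₐ[K] W)
    (haa : ∀ {i j}, i ≠ j → ∀ x y, Commute (a i x) (a j y))
    (hbb : ∀ {i j}, i ≠ j → ∀ x y, Commute (b i x) (b j y))
    (hab : ∀ i j x y, Commute (a i x) (b j y))
    {p pinv : A ⊗[K] A} {p' p'inv : B ⊗[K] B} {r rinv q qinv : A ⊗[K] B}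
    {σ τ : A ≃ₐ[K] A} {σ' τ' : B ≃ₐ[K] B}
    (hp : IsOQA K p pinv σ τ) (hp' : IsOQA K p' p'inv σ' τ')
    (hr : IsOQANonuple K p pinv p' p'inv r rinv σ τ σ' τ')
    (hq : IsOQANonuple K p pinv p' p'inv q qinv σ τ σ' τ')
    (h39 : emb21 K B A B qinv * emb13 K B A B p' * emb23 K B A B r =
      emb23 K B A B r * emb13 K B A B p' * emb21 K B A B qinv)
    (h310 : emb12 K A B A r * emb13 K A B A p * emb32 K A B A qinv =
      emb32 K A B A qinv * emb13 K A B A p * emb12 K A B A r) :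
    (mulPair (a 0) (b 1) r * mulPair (a 0) (a 1) p * mulPair (b 0) (b 1) p' *
        mulPair (a 1) (b 0) qinv) *
      (mulPair (a 0) (b 2) r * mulPair (a 0) (a 2) p * mulPair (b 0) (b 2) p' *
        mulPair (a 2) (b 0) qinv) *
      (mulPair (a 1) (b 2) r * mulPair (a 1) (a 2) p * mulPair (b 1) (b 2) p' *
        mulPair (a 2) (b 1) qinv) =
    (mulPair (a 1) (b 2) r * mulPair (a 1) (a 2) p * mulPair (b 1) (b 2) p' *
        mulPair (a 2) (b 1) qinv) *
      (mulPair (a 0) (b 2) r * mulPair (a 0) (a 2) p * mulPair (b 0) (b 2) p' *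
        mulPair (a 2) (b 0) qinv) *
      (mulPair (a 0) (b 1) r * mulPair (a 0) (a 1) p * mulPair (b 0) (b 1) p' *
        mulPair (a 1) (b 0) qinv) := by
  have hba : ∀ i j x y, Commute (b i x) (a j y) := fun i j x y => (hab j i y x).symm
  have h01 : (0 : Fin 3) ≠ 1 := by decide
  have h02 : (0 : Fin 3) ≠ 2 := by decide
  have h12 : (1 : Fin 3) ≠ 2 := by decide
  have caab {i j : Fin 3} (hij : i ≠ j) (k : Fin 3) {x : A ⊗[K] B}
      (hx : emb12 K A A B p * emb13 K A A B x * emb23 K A A B x =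
        emb23 K A A B x * emb13 K A A B x * emb12 K A A B p) :
      mulPair (a i) (a j) p * mulPair (a i) (b k) x * mulPair (a j) (b k) x =
        mulPair (a j) (b k) x * mulPair (a i) (b k) x * mulPair (a i) (a j) p := by
    simpa only [map_mul, lift₃_emb12, lift₃_emb13, lift₃_emb23] using
      congrArg (lift₃ (a i) (a j) (b k) (haa hij) (hab i k) (hab j k)) hx
  have cabb (i : Fin 3) {j k : Fin 3} (hjk : j ≠ k) {x : A ⊗[K] B}
      (hx : emb12 K A B B x * emb13 K A B B x * emb23 K A B B p' =
        emb23 K A B B p' * emb13 K A B B x * emb12 K A B B x) :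
      mulPair (a i) (b j) x * mulPair (a i) (b k) x * mulPair (b j) (b k) p' =
        mulPair (b j) (b k) p' * mulPair (a i) (b k) x * mulPair (a i) (b j) x := by
    simpa only [map_mul, lift₃_emb12, lift₃_emb13, lift₃_emb23] using
      congrArg (lift₃ (a i) (b j) (b k) (hab i j) (hab i k) (hbb hjk)) hx
  have qQ (i j : Fin 3) : mulPair (a i) (b j) q * mulPair (a i) (b j) qinv = 1 :=
    mulPair_mul_eq_one _ _ (hab i j) hq.r_mul_inv
  have Qq (i j : Fin 3) : mulPair (a i) (b j) qinv * mulPair (a i) (b j) q = 1 :=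
    mulPair_mul_eq_one _ _ (hab i j) hq.r_inv_mul
  apply yangBaxter_of_relations
  · simpa only [map_mul, lift₃_emb12, lift₃_emb13, lift₃_emb23] using
      congrArg (lift₃ (a 0) (a 1) (a 2) (haa h01) (haa h02) (haa h12)) hp.qybe
  · simpa only [map_mul, lift₃_emb12, lift₃_emb13, lift₃_emb23] using
      congrArg (lift₃ (b 0) (b 1) (b 2) (hbb h01) (hbb h02) (hbb h12)) hp'.qybe
  · exact caab h01 2 hr.cond3
  · exact cabb 0 h12 hr.cond4
  · exact mul_mul_inv_swap (qQ 1 0) (Qq 1 0) (qQ 2 0) (Qq 2 0) (caab h12 0 hq.cond3)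
  · exact mul_mul_inv_swap (qQ 2 1) (Qq 2 1) (qQ 2 0) (Qq 2 0) (cabb 2 h01 hq.cond4).symm
  · simpa only [map_mul, lift₃_emb21, lift₃_emb13, lift₃_emb23] using
      congrArg (lift₃ (b 0) (a 1) (b 2) (hba 0 1) (hbb h02) (hab 1 2)) h39
  · simpa only [map_mul, lift₃_emb12, lift₃_emb13, lift₃_emb32] using
      congrArg (lift₃ (a 0) (b 1) (a 2) (hab 0 1) (haa h02) (hba 1 2)) h310
  all_goals
    apply commute_mulPair <;>
      first
      | exact hab _ _
      | exact hba _ _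
      | exact haa (by decide)
      | exact hbb (by decide)

end Product

/-- Theorem 3.5: two OQA nonuples with common `p, p'` and compatibility
conditions (3.9), (3.10) give an OQA structure
`α̃ = r_k pᵢ ⊗ p'ⱼ Q^t ⊗ pⁱ Q_t ⊗ r^k p'ʲ` on `H ⊗ H'`. -/
theorem oqa_from_two_nonuples (K : Type*) [Field K] (A B : Type*) [Ring A] [Ring B]
    [Algebra K A] [Algebra K B]
    (p pinv : A ⊗[K] A) (p' p'inv : B ⊗[K] B) (r rinv q qinv : A ⊗[K] B)
    (σ τ : A ≃ₐ[K] A) (σ' τ' : B ≃ₐ[K] B)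
    (hp : IsOQA K p pinv σ τ) (hp' : IsOQA K p' p'inv σ' τ')
    (hr : IsOQANonuple K p pinv p' p'inv r rinv σ τ σ' τ')
    (hq : IsOQANonuple K p pinv p' p'inv q qinv σ τ σ' τ')
    (h39 : emb21 K B A B qinv * emb13 K B A B p' * emb23 K B A B r =
      emb23 K B A B r * emb13 K B A B p' * emb21 K B A B qinv)
    (h310 : emb12 K A B A r * emb13 K A B A p * emb32 K A B A qinv =
      emb32 K A B A qinv * emb13 K A B A p * emb12 K A B A r) :
    IsOQA K
      (E14 K A B A B r * E13 K A B A B p * E24 K A B A B p' * E32 K A B A B qinv)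
      (E32 K A B A B q * E13 K A B A B pinv * E24 K A B A B p'inv * E14 K A B A B rinv)
      (Algebra.TensorProduct.congr σ σ') (Algebra.TensorProduct.congr τ τ') := by
  have hσ : (Algebra.TensorProduct.congr σ σ').toAlgHom =
      Algebra.TensorProduct.map σ.toAlgHom σ'.toAlgHom := rfl
  have hτ : (Algebra.TensorProduct.congr τ τ').toAlgHom =
      Algebra.TensorProduct.map τ.toAlgHom τ'.toAlgHom := rfl
  have hid : AlgHom.id K (A ⊗[K] B) =
      Algebra.TensorProduct.map (AlgHom.id K A) (AlgHom.id K B) := by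
    rw [Algebra.TensorProduct.map_id]
  have hqσ := map_eq_self_of_mul_eq_one _ hq.r_mul_inv hq.r_inv_mul hq.map_sigma
  have hqτ := map_eq_self_of_mul_eq_one _ hq.r_mul_inv hq.r_inv_mul hq.map_tau
  have c12 (x : A) (y : B) : Commute (opIncl₁ K A B x) (opIncl₂ K A B y) := by
    simp [Commute, SemiconjBy, opIncl₁_apply, opIncl₂_apply]
  have c13 (x : A) (y : Aᵐᵒᵖ) : Commute (opIncl₁ K A B x) (opIncl₃ K A B y) := by
    simp [Commute, SemiconjBy, opIncl₁_apply, opIncl₃_apply]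
  have c14 (x : A) (y : Bᵐᵒᵖ) : Commute (opIncl₁ K A B x) (opIncl₄ K A B y) := by
    simp [Commute, SemiconjBy, opIncl₁_apply, opIncl₄_apply]
  have c23 (x : B) (y : Aᵐᵒᵖ) : Commute (opIncl₂ K A B x) (opIncl₃ K A B y) := by
    simp [Commute, SemiconjBy, opIncl₂_apply, opIncl₃_apply]
  have c24 (x : B) (y : Bᵐᵒᵖ) : Commute (opIncl₂ K A B x) (opIncl₄ K A B y) := by
    simp [Commute, SemiconjBy, opIncl₂_apply, opIncl₄_apply]
  have c34 (x : Aᵐᵒᵖ) (y : Bᵐᵒᵖ) : Commute (opIncl₃ K A B x) (opIncl₄ K A B y) := by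
    simp [Commute, SemiconjBy, opIncl₃_apply, opIncl₄_apply, ← MulOpposite.op_mul]
  have c1423 (s : A ⊗[K] Bᵐᵒᵖ) (t : B ⊗[K] Aᵐᵒᵖ) :
      Commute (mulPair (opIncl₁ K A B) (opIncl₄ K A B) s)
        (mulPair (opIncl₂ K A B) (opIncl₃ K A B) t) :=
    commute_mulPair _ _ _ _ c12 c13 (fun x y => (c24 y x).symm) (fun x y => (c34 y x).symm) s t
  obtain ⟨hQ, hq'⟩ := opify_map_swap hq.map_sigma hqτ
  constructor
  · intro x
    induction x with
    | zero => simp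
    | add x y hx hy => simp only [map_add, hx, hy]
    | tmul x y => simp [hr.comm_auto, hr.comm_auto']
  · exact mul_eq_one_of_four (by rw [← map_mul, hq.r_inv_mul, map_one])
      (by rw [← map_mul, hp'.mul_inv, map_one]) (by rw [← map_mul, hp.mul_inv, map_one])
      (by rw [← map_mul, hr.r_mul_inv, map_one]) (commute_E13_E24 _ _)
  · exact mul_eq_one_of_four (by rw [← map_mul, hr.r_inv_mul, map_one])
      (by rw [← map_mul, hp'.inv_mul, map_one]) (by rw [← map_mul, hp.inv_mul, map_one])
      (by rw [← map_mul, hq.r_mul_inv, map_one]) (commute_E13_E24 _ _)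
  · rw [hσ, hτ, hid]
    simp only [map_mul, map_map_E13, map_map_E14, map_map_E24, map_map_E32]
    rw [opify_product, opify_product_inv]
    refine mul_eq_one_of_four (mulPair_mul_eq_one _ _ c24 hp'.op_mul_inv)
      (mulPair_mul_eq_one _ _ c23 ?_) (mulPair_mul_eq_one _ _ c14 hr.op_mul_inv)
      (mulPair_mul_eq_one _ _ c13 hp.op_mul_inv) (c1423 _ _)
    rw [hQ, hq', ← opSwap_mul, ← map_mul, hq.op_mul_inv, map_one, opSwap_one]
  · rw [hσ, hτ, hid]
    simp only [map_mul, map_map_E13, map_map_E14, map_map_E24, map_map_E32]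
    rw [opify_product, opify_product_inv]
    refine mul_eq_one_of_four (mulPair_mul_eq_one _ _ c13 hp.op_inv_mul)
      (mulPair_mul_eq_one _ _ c23 ?_) (mulPair_mul_eq_one _ _ c14 hr.op_inv_mul)
      (mulPair_mul_eq_one _ _ c24 hp'.op_inv_mul) (c1423 _ _)
    rw [hQ, hq', ← opSwap_mul, ← map_mul, hq.op_inv_mul, map_one, opSwap_one]
  · rw [hσ]
    simp only [map_mul, map_map_E13, map_map_E14, map_map_E24, map_map_E32, hp.map_sigma,
      hp'.map_sigma, hr.map_sigma, hqσ]
  · rw [hτ]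
    simp only [map_mul, map_map_E13, map_map_E14, map_map_E24, map_map_E32, hp.map_tau,
      hp'.map_tau, hr.map_tau, hqτ]
  · let a (i : Fin 3) := (slot K (A ⊗[K] B) i).comp
      (Algebra.TensorProduct.includeLeft : A →ₐ[K] A ⊗[K] B)
    let b (i : Fin 3) := (slot K (A ⊗[K] B) i).comp
      (Algebra.TensorProduct.includeRight : B →ₐ[K] A ⊗[K] B)
    have hab (i j : Fin 3) (x : A) (y : B) : Commute (a i x) (b j y) := by
      by_cases hij : i = j
      · subst hij
        exact Commute.map (by simp [Commute, SemiconjBy]) (slot K (A ⊗[K] B) i)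
      · exact commute_slot hij _ _
    rw [map_product (emb12 K (A ⊗[K] B) (A ⊗[K] B) (A ⊗[K] B)) (f₁ := a 0) (f₂ := b 0)
        (f₃ := a 1) (f₄ := b 1) (fun _ => rfl) (fun _ => rfl) (fun _ => rfl) (fun _ => rfl),
      map_product (emb13 K (A ⊗[K] B) (A ⊗[K] B) (A ⊗[K] B)) (f₁ := a 0) (f₂ := b 0)
        (f₃ := a 2) (f₄ := b 2) (fun _ => rfl) (fun _ => rfl) (fun _ => rfl) (fun _ => rfl),
      map_product (emb23 K (A ⊗[K] B) (A ⊗[K] B) (A ⊗[K] B)) (f₁ := a 1) (f₂ := b 1)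
        (f₃ := a 2) (f₄ := b 2) (fun _ => rfl) (fun _ => rfl) (fun _ => rfl) (fun _ => rfl)]
    exact yangBaxter_mulPair a b (fun hij _ _ => commute_slot hij _ _)
      (fun hij _ _ => commute_slot hij _ _) hab hp hp' hr hq h39 h310
end
end

section
/- Suppose (H, p, D, U) and (H', p', D', U') are oriented quantum algebras and (H, H', p, p', r, D, U, D', U') is an OQA nonuple. Write p = pᵢ ⊗ pⁱ, p' = p'ⱼ ⊗ p'ʲ, r = r_k ⊗ r^k and r⁻¹ = R_n ⊗ R^n. Then (H ⊗ H', α̃, D ⊗ D', U ⊗ U') is an oriented quantum algebra, where α̃ = (r_k pᵢ ⊗ p'ⱼ R^n) ⊗ (pⁱ R_n ⊗ r^k p'ʲ), with inverse α̃⁻¹ = (P_l R_n ⊗ r^k P'_m) ⊗ (r_k P^l ⊗ P'^m R^n) where p⁻¹ = P_l ⊗ P^l and p'⁻¹ = P'_m ⊗ P'^m. -/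
open TensorProduct

noncomputable section

namespace OQApaper

section FusedYangBaxter

variable {T : Type*} [Monoid T]

theorem yang_baxter_conj_mid {x y z zi : T} (h : y * x * z = z * x * y) (h₁ : z * zi = 1)
    (h₂ : zi * z = 1) : x * y * zi = zi * y * x := by
  calc x * y * zi = zi * (z * x * y) * zi := by simp only [← mul_assoc, h₂, one_mul]
    _ = zi * y * x := by rw [← h]; simp only [mul_assoc, h₁, mul_one]

theorem yang_baxter_conj_pair {x xi y yi z : T} (h : z * x * y = y * x * z) (hx : x * xi = 1)
    (hx' : xi * x = 1) (hy : y * yi = 1) (hy' : yi * y = 1) :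
    xi * yi * z = z * yi * xi := by
  have key : xi * (yi * y) * x * (z * (yi * xi)) = xi * yi * z := by
    calc xi * (yi * y) * x * (z * (yi * xi)) = xi * yi * (y * x * z) * yi * xi := by
          simp only [mul_assoc]
      _ = xi * yi * z * (x * (y * yi) * xi) := by rw [← h]; simp only [mul_assoc]
      _ = xi * yi * z := by rw [hy, mul_one, hx, mul_one]
  rw [hy', mul_one, hx', one_mul] at key
  rw [← key, mul_assoc]

/-- The Yang–Baxter relation for strands `a`, `b` and the fusion of `c` with `d`. -/
theorem yang_baxter_fuse_right {ab ac ad bc bd : T} (hc : ab * ac * bc = bc * ac * ab)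
    (hd : ab * ad * bd = bd * ad * ab) (h₁ : Commute ac bd) (h₂ : Commute ad bc) :
    ab * (ad * ac) * (bd * bc) = (bd * bc) * (ad * ac) * ab := by
  calc ab * (ad * ac) * (bd * bc) = ab * ad * (ac * bd) * bc := by simp only [mul_assoc]
    _ = (ab * ad * bd) * ac * bc := by rw [h₁.eq]; simp only [mul_assoc]
    _ = bd * ad * (ab * ac * bc) := by rw [hd]; simp only [mul_assoc]
    _ = bd * (ad * bc) * ac * ab := by rw [hc]; simp only [mul_assoc]
    _ = (bd * bc) * (ad * ac) * ab := by rw [h₂.eq]; simp only [mul_assoc]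

/-- The Yang–Baxter relation for two strands each fused from two strands, against a third one. -/
theorem yang_baxter_fuse_left {x₁₃ x₁₄ x₂₃ x₂₄ y₁ y₂ y₃ y₄ : T}
    (h₁₃ : x₁₃ * y₁ * y₃ = y₃ * y₁ * x₁₃) (h₁₄ : x₁₄ * y₁ * y₄ = y₄ * y₁ * x₁₄)
    (h₂₃ : x₂₃ * y₂ * y₃ = y₃ * y₂ * x₂₃) (h₂₄ : x₂₄ * y₂ * y₄ = y₄ * y₂ * x₂₄)
    (c₁₃₂ : Commute x₁₃ y₂) (c₁₃₄ : Commute x₁₃ y₄) (c₁₄₂ : Commute x₁₄ y₂)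
    (c₁₄₃ : Commute x₁₄ y₃) (c₂₃₁ : Commute x₂₃ y₁) (c₂₃₄ : Commute x₂₃ y₄)
    (c₂₄₁ : Commute x₂₄ y₁) (c₂₄₃ : Commute x₂₄ y₃) :
    (x₁₄ * x₁₃ * x₂₄ * x₂₃) * (y₁ * y₂) * (y₃ * y₄) =
      (y₃ * y₄) * (y₁ * y₂) * (x₁₄ * x₁₃ * x₂₄ * x₂₃) := by
  calc (x₁₄ * x₁₃ * x₂₄ * x₂₃) * (y₁ * y₂) * (y₃ * y₄)
      = x₁₄ * x₁₃ * x₂₄ * (x₂₃ * y₁) * y₂ * y₃ * y₄ := by simp only [mul_assoc]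
    _ = x₁₄ * x₁₃ * (x₂₄ * y₁) * (x₂₃ * y₂ * y₃) * y₄ := by rw [c₂₃₁.eq]; simp only [mul_assoc]
    _ = x₁₄ * x₁₃ * y₁ * (x₂₄ * y₃) * y₂ * (x₂₃ * y₄) := by
        rw [c₂₄₁.eq, h₂₃]; simp only [mul_assoc]
    _ = x₁₄ * (x₁₃ * y₁ * y₃) * (x₂₄ * y₂ * y₄) * x₂₃ := by
        rw [c₂₄₃.eq, c₂₃₄.eq]; simp only [mul_assoc]
    _ = (x₁₄ * y₃) * y₁ * (x₁₃ * y₄) * y₂ * x₂₄ * x₂₃ := by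
        rw [h₁₃, h₂₄]; simp only [mul_assoc]
    _ = y₃ * (x₁₄ * y₁ * y₄) * (x₁₃ * y₂) * x₂₄ * x₂₃ := by
        rw [c₁₄₃.eq, c₁₃₄.eq]; simp only [mul_assoc]
    _ = y₃ * y₄ * y₁ * (x₁₄ * y₂) * x₁₃ * x₂₄ * x₂₃ := by
        rw [h₁₄, c₁₃₂.eq]; simp only [mul_assoc]
    _ = _ := by rw [c₁₄₂.eq]; simp only [mul_assoc]

theorem mul_cancel_left_of_eq_one {x y : T} (h : x * y = 1) (z : T) : x * (y * z) = z := by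
  rw [← mul_assoc, h, one_mul]

end FusedYangBaxter

variable {K : Type*} [Field K]

theorem algHom_mul_eq_one {X Y : Type*} [Ring X] [Ring Y] [Algebra K X] [Algebra K Y]
    (F : X →ₐ[K] Y) {x y : X} (h : x * y = 1) : F x * F y = 1 := by
  rw [← map_mul, h, map_one]

section MulMap

variable {A B C T : Type*} [Ring A] [Ring B] [Ring C] [Ring T]
  [Algebra K A] [Algebra K B] [Algebra K C] [Algebra K T]

/-- The linear map `a ⊗ b ↦ f a * g b`. -/
def mulMap (f : A →ₐ[K] T) (g : B →ₐ[K] T) : A ⊗[K] B →ₗ[K] T :=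
  LinearMap.mul' K T ∘ₗ TensorProduct.map f.toLinearMap g.toLinearMap

@[simp]
theorem mulMap_tmul (f : A →ₐ[K] T) (g : B →ₐ[K] T) (a : A) (b : B) :
    mulMap f g (a ⊗ₜ b) = f a * g b := rfl

theorem mulMap_eq_lift (f : A →ₐ[K] T) (g : B →ₐ[K] T) (h : ∀ a b, Commute (f a) (g b))
    (x : A ⊗[K] B) : mulMap f g x = Algebra.TensorProduct.lift f g h x := by
  induction x with
  | zero => simp
  | tmul a b => simp
  | add x y hx hy => simp [hx, hy]

theorem mulMap_mul_eq_one {f : A →ₐ[K] T} {g : B →ₐ[K] T} (h : ∀ a b, Commute (f a) (g b))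
    {x y : A ⊗[K] B} (hxy : x * y = 1) : mulMap f g x * mulMap f g y = 1 := by
  rw [mulMap_eq_lift f g h, mulMap_eq_lift f g h, ← map_mul, hxy, map_one]

theorem commute_mulMap {f : A →ₐ[K] T} {g : B →ₐ[K] T} {t : T} (hf : ∀ a, Commute (f a) t)
    (hg : ∀ b, Commute (g b) t) (x : A ⊗[K] B) : Commute (mulMap f g x) t := by
  induction x with
  | zero => simp
  | tmul a b => exact (hf a).mul_left (hg b)
  | add x y hx hy => rw [map_add]; exact hx.add_left hy

theorem commute_mulMap_mulMap {D : Type*} [Ring D] [Algebra K D]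
    {f : A →ₐ[K] T} {g : B →ₐ[K] T} {f' : C →ₐ[K] T} {g' : D →ₐ[K] T}
    (h₁ : ∀ a c, Commute (f a) (f' c)) (h₂ : ∀ a d, Commute (f a) (g' d))
    (h₃ : ∀ b c, Commute (g b) (f' c)) (h₄ : ∀ b d, Commute (g b) (g' d))
    (x : A ⊗[K] B) (y : C ⊗[K] D) : Commute (mulMap f g x) (mulMap f' g' y) :=
  commute_mulMap
    (fun a => (commute_mulMap (fun c => (h₁ a c).symm) (fun d => (h₂ a d).symm) y).symm)
    (fun b => (commute_mulMap (fun c => (h₃ b c).symm) (fun d => (h₄ b d).symm) y).symm) x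

theorem mulMap_yang_baxter {f : A →ₐ[K] T} {g : B →ₐ[K] T} {h : C →ₐ[K] T}
    (hfg : ∀ a b, Commute (f a) (g b)) (hfh : ∀ a c, Commute (f a) (h c))
    (hgh : ∀ b c, Commute (g b) (h c)) {x : A ⊗[K] B} {y : A ⊗[K] C} {z : B ⊗[K] C}
    (H : emb12 K A B C x * emb13 K A B C y * emb23 K A B C z =
      emb23 K A B C z * emb13 K A B C y * emb12 K A B C x) :
    mulMap f g x * mulMap f h y * mulMap g h z =
      mulMap g h z * mulMap f h y * mulMap f g x := by
  have hc : ∀ a (w : B ⊗[K] C), Commute (f a) (Algebra.TensorProduct.lift g h hgh w) :=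
    fun a w => by
      rw [← mulMap_eq_lift]
      exact (commute_mulMap (fun b => (hfg a b).symm) (fun c => (hfh a c).symm) w).symm
  have h₁ : ∀ w, Algebra.TensorProduct.lift f (Algebra.TensorProduct.lift g h hgh) hc
      (emb12 K A B C w) = mulMap f g w := fun w => by
    induction w with
    | zero => simp
    | tmul a b => simp [emb12]
    | add x y hx hy => simp only [map_add, hx, hy]
  have h₂ : ∀ w, Algebra.TensorProduct.lift f (Algebra.TensorProduct.lift g h hgh) hc
      (emb13 K A B C w) = mulMap f h w := fun w => by
    induction w with
    | zero => simp
    | tmul a b => simp [emb13]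
    | add x y hx hy => simp only [map_add, hx, hy]
  have h₃ : ∀ w, Algebra.TensorProduct.lift f (Algebra.TensorProduct.lift g h hgh) hc
      (emb23 K A B C w) = mulMap g h w := fun w => by
    induction w with
    | zero => simp
    | tmul a b => simp [emb23]
    | add x y hx hy => simp only [map_add, hx, hy]
  simpa only [map_mul, h₁, h₂, h₃] using
    congrArg (Algebra.TensorProduct.lift f (Algebra.TensorProduct.lift g h hgh) hc) H

end MulMap

variable {A B : Type*} [Ring A] [Ring B] [Algebra K A] [Algebra K B]

section Strands

variable {T : Type*} [Ring T] [Algebra K T]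

/-- The braiding of the fused strand `(i, j)` with the fused strand `(i', j')`. -/
def fusedBraid (p : A ⊗[K] A) (p' : B ⊗[K] B) (r rinv : A ⊗[K] B)
    (i : A →ₐ[K] T) (j : B →ₐ[K] T) (i' : A →ₐ[K] T) (j' : B →ₐ[K] T) : T :=
  mulMap i j' r * mulMap i i' p * mulMap j j' p' * mulMap i' j rinv

theorem map_fusedBraid {p : A ⊗[K] A} {p' : B ⊗[K] B} {r rinv : A ⊗[K] B}
    (F : (A ⊗[K] B) ⊗[K] (A ⊗[K] B) →ₐ[K] T)
    {i : A →ₐ[K] T} {j : B →ₐ[K] T} {i' : A →ₐ[K] T} {j' : B →ₐ[K] T}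
    (hi : ∀ a, F ((a ⊗ₜ 1) ⊗ₜ 1) = i a) (hj : ∀ b, F ((1 ⊗ₜ b) ⊗ₜ 1) = j b)
    (hi' : ∀ a, F (1 ⊗ₜ (a ⊗ₜ 1)) = i' a) (hj' : ∀ b, F (1 ⊗ₜ (1 ⊗ₜ b)) = j' b) :
    F (E14 K A B A B r * E13 K A B A B p * E24 K A B A B p' * E32 K A B A B rinv) =
      fusedBraid p p' r rinv i j i' j' := by
  have h₁₄ : ∀ x, F (E14 K A B A B x) = mulMap i j' x := fun x => by
    induction x with
    | zero => simp
    | tmul a b => simp [E14, ← hi, ← hj', ← map_mul]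
    | add x y hx hy => simp only [map_add, hx, hy]
  have h₁₃ : ∀ x, F (E13 K A B A B x) = mulMap i i' x := fun x => by
    induction x with
    | zero => simp
    | tmul a b => simp [E13, ← hi, ← hi', ← map_mul]
    | add x y hx hy => simp only [map_add, hx, hy]
  have h₂₄ : ∀ x, F (E24 K A B A B x) = mulMap j j' x := fun x => by
    induction x with
    | zero => simp
    | tmul a b => simp [E24, ← hj, ← hj', ← map_mul]
    | add x y hx hy => simp only [map_add, hx, hy]
  have h₃₂ : ∀ x, F (E32 K A B A B x) = mulMap i' j x := fun x => by
    induction x with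
    | zero => simp
    | tmul a b => simp [E32, E23, ← hi', ← hj, ← map_mul]
    | add x y hx hy => simp only [map_add, hx, hy]
  simp only [map_mul, h₁₄, h₁₃, h₂₄, h₃₂, fusedBraid]

theorem fusedBraid_yang_baxter {p : A ⊗[K] A} {p' : B ⊗[K] B} {r rinv : A ⊗[K] B}
    (hr : r * rinv = 1) (hr' : rinv * r = 1)
    (hp : emb12 K A A A p * emb13 K A A A p * emb23 K A A A p =
      emb23 K A A A p * emb13 K A A A p * emb12 K A A A p)
    (hp' : emb12 K B B B p' * emb13 K B B B p' * emb23 K B B B p' =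
      emb23 K B B B p' * emb13 K B B B p' * emb12 K B B B p')
    (hpr : emb12 K A A B p * emb13 K A A B r * emb23 K A A B r =
      emb23 K A A B r * emb13 K A A B r * emb12 K A A B p)
    (hrp' : emb12 K A B B r * emb13 K A B B r * emb23 K A B B p' =
      emb23 K A B B p' * emb13 K A B B r * emb12 K A B B r)
    (i : Fin 3 → A →ₐ[K] T) (j : Fin 3 → B →ₐ[K] T)
    (hi : ∀ s t, s ≠ t → ∀ a b, Commute (i s a) (i t b))
    (hj : ∀ s t, s ≠ t → ∀ a b, Commute (j s a) (j t b))
    (hij : ∀ s t a b, Commute (i s a) (j t b)) :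
    fusedBraid p p' r rinv (i 0) (j 0) (i 1) (j 1) *
        fusedBraid p p' r rinv (i 0) (j 0) (i 2) (j 2) *
        fusedBraid p p' r rinv (i 1) (j 1) (i 2) (j 2) =
      fusedBraid p p' r rinv (i 1) (j 1) (i 2) (j 2) *
        fusedBraid p p' r rinv (i 0) (j 0) (i 2) (j 2) *
        fusedBraid p p' r rinv (i 0) (j 0) (i 1) (j 1) := by
  have hji : ∀ s t a b, Commute (j s a) (i t b) := fun s t a b => (hij t s b a).symm
  have i01 := hi 0 1 (by decide)
  have i02 := hi 0 2 (by decide)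
  have i12 := hi 1 2 (by decide)
  have i10 := hi 1 0 (by decide)
  have i20 := hi 2 0 (by decide)
  have i21 := hi 2 1 (by decide)
  have j01 := hj 0 1 (by decide)
  have j02 := hj 0 2 (by decide)
  have j12 := hj 1 2 (by decide)
  have j10 := hj 1 0 (by decide)
  have j20 := hj 2 0 (by decide)
  have j21 := hj 2 1 (by decide)
  have inv : ∀ s t, mulMap (i s) (j t) r * mulMap (i s) (j t) rinv = 1 :=
    fun s t => mulMap_mul_eq_one (hij s t) hr
  have inv' : ∀ s t, mulMap (i s) (j t) rinv * mulMap (i s) (j t) r = 1 :=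
    fun s t => mulMap_mul_eq_one (hij s t) hr'
  have aaa := mulMap_yang_baxter i01 i02 i12 hp
  have aab := mulMap_yang_baxter i01 (hij 0 2) (hij 1 2) hpr
  have aba := yang_baxter_conj_mid (mulMap_yang_baxter i02 (hij 0 1) (hij 2 1) hpr)
    (inv 2 1) (inv' 2 1)
  have baa := yang_baxter_conj_pair (mulMap_yang_baxter i12 (hij 1 0) (hij 2 0) hpr)
    (inv 1 0) (inv' 1 0) (inv 2 0) (inv' 2 0)
  have abb := mulMap_yang_baxter (hij 0 1) (hij 0 2) j12 hrp'
  have bab := (yang_baxter_conj_mid (mulMap_yang_baxter (hij 1 0) (hij 1 2) j02 hrp').symm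
    (inv 1 0) (inv' 1 0)).symm
  have bba := (yang_baxter_conj_pair (mulMap_yang_baxter (hij 2 0) (hij 2 1) j01 hrp').symm
    (inv 2 1) (inv' 2 1) (inv 2 0) (inv' 2 0)).symm
  have bbb := mulMap_yang_baxter j01 j02 j12 hp'
  have key := yang_baxter_fuse_left
    (yang_baxter_fuse_right aaa aab
      (commute_mulMap_mulMap i01 (hij 0 2) i21 (hij 2 2) _ _)
      (commute_mulMap_mulMap i01 i02 (hji 2 1) (hji 2 2) _ _))
    (yang_baxter_fuse_right aba abb
      (commute_mulMap_mulMap (hij 0 1) (hij 0 2) (hij 2 1) (hij 2 2) _ _)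
      (commute_mulMap_mulMap i02 (hij 0 1) (hji 2 2) j21 _ _))
    (yang_baxter_fuse_right baa bab
      (commute_mulMap_mulMap i21 (hij 2 2) (hji 0 1) j02 _ _)
      (commute_mulMap_mulMap (hji 0 1) (hji 0 2) (hji 2 1) (hji 2 2) _ _))
    (yang_baxter_fuse_right bba bbb
      (commute_mulMap_mulMap (hij 2 1) (hij 2 2) j01 j02 _ _)
      (commute_mulMap_mulMap (hji 0 2) j01 (hji 2 2) j21 _ _))
    ((commute_mulMap_mulMap (hij 0 0) (hij 0 2) (hij 1 0) (hij 1 2) _ _).mul_right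
      (commute_mulMap_mulMap i02 (hij 0 0) i12 (hij 1 0) _ _))
    ((commute_mulMap_mulMap (hij 0 1) (hij 0 2) (hij 1 1) (hij 1 2) _ _).mul_right
      (commute_mulMap_mulMap i02 (hij 0 1) i12 (hij 1 1) _ _))
    ((commute_mulMap_mulMap (hij 0 0) (hij 0 2) j10 j12 _ _).mul_right
      (commute_mulMap_mulMap i02 (hij 0 0) (hji 1 2) j10 _ _))
    ((commute_mulMap_mulMap i01 (hij 0 2) (hji 1 1) j12 _ _).mul_right
      (commute_mulMap_mulMap i01 i02 (hji 1 1) (hji 1 2) _ _))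
    ((commute_mulMap_mulMap i10 (hij 1 2) (hji 0 0) j02 _ _).mul_right
      (commute_mulMap_mulMap i10 i12 (hji 0 0) (hji 0 2) _ _))
    ((commute_mulMap_mulMap (hij 1 1) (hij 1 2) j01 j02 _ _).mul_right
      (commute_mulMap_mulMap i12 (hij 1 1) (hji 0 2) j01 _ _))
    ((commute_mulMap_mulMap (hji 0 0) j02 (hji 1 0) j12 _ _).mul_right
      (commute_mulMap_mulMap (hji 0 0) (hji 0 2) (hji 1 0) (hji 1 2) _ _))
    ((commute_mulMap_mulMap (hji 0 1) j02 (hji 1 1) j12 _ _).mul_right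
      (commute_mulMap_mulMap (hji 0 1) (hji 0 2) (hji 1 1) (hji 1 2) _ _))
  simpa only [fusedBraid, mul_assoc] using key

end Strands

section Opposite

theorem opify_comm_mul_eq_one {x y : A ⊗[K] B} (h : opify K A B y * opify K A B x = 1) :
    opify K B A (TensorProduct.comm K A B x) * opify K B A (TensorProduct.comm K A B y) = 1 := by
  let s : A ⊗[K] Bᵐᵒᵖ →ₗ[K] B ⊗[K] Aᵐᵒᵖ :=
    opify K B A ∘ₗ (TensorProduct.comm K A B).toLinearMap ∘ₗ
      TensorProduct.map LinearMap.id (MulOpposite.opLinearEquiv K).symm.toLinearMap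
  have hs : ∀ x, s (opify K A B x) = opify K B A (TensorProduct.comm K A B x) := fun x => by
    induction x with
    | zero => simp
    | tmul a b => simp [s, opify]
    | add x y hx hy => simp only [map_add, hx, hy]
  have hmul : ∀ u v, s (u * v) = s v * s u := fun u v => by
    induction u with
    | zero => simp
    | add u w hu hw => simp only [add_mul, mul_add, map_add, hu, hw]
    | tmul a b =>
      induction v with
      | zero => simp
      | add u w hu hw => simp only [add_mul, mul_add, map_add, hu, hw]
      | tmul c d => simp [s, opify]
  rw [← hs, ← hs, ← hmul, h]
  simp [s, opify, Algebra.TensorProduct.one_def]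

variable (K A B) in
/-- The inclusion of `A` into the first factor of `(A ⊗ B) ⊗ (A ⊗ B)ᵐᵒᵖ`. -/
def opStrandA : A →ₐ[K] (A ⊗[K] B) ⊗[K] (A ⊗[K] B)ᵐᵒᵖ :=
  Algebra.TensorProduct.includeLeft.comp Algebra.TensorProduct.includeLeft

variable (K A B) in
/-- The inclusion of `B` into the first factor of `(A ⊗ B) ⊗ (A ⊗ B)ᵐᵒᵖ`. -/
def opStrandB : B →ₐ[K] (A ⊗[K] B) ⊗[K] (A ⊗[K] B)ᵐᵒᵖ :=
  Algebra.TensorProduct.includeLeft.comp Algebra.TensorProduct.includeRight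

variable (K A B) in
/-- The inclusion of `Aᵐᵒᵖ` into the second factor of `(A ⊗ B) ⊗ (A ⊗ B)ᵐᵒᵖ`. -/
def opStrandAOp : Aᵐᵒᵖ →ₐ[K] (A ⊗[K] B) ⊗[K] (A ⊗[K] B)ᵐᵒᵖ :=
  Algebra.TensorProduct.includeRight.comp (AlgHom.op Algebra.TensorProduct.includeLeft)

variable (K A B) in
/-- The inclusion of `Bᵐᵒᵖ` into the second factor of `(A ⊗ B) ⊗ (A ⊗ B)ᵐᵒᵖ`. -/
def opStrandBOp : Bᵐᵒᵖ →ₐ[K] (A ⊗[K] B) ⊗[K] (A ⊗[K] B)ᵐᵒᵖ :=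
  Algebra.TensorProduct.includeRight.comp (AlgHom.op Algebra.TensorProduct.includeRight)

theorem opStrandA_apply (a : A) : opStrandA K A B a = (a ⊗ₜ 1) ⊗ₜ 1 := rfl

theorem opStrandB_apply (b : B) : opStrandB K A B b = (1 ⊗ₜ b) ⊗ₜ 1 := rfl

theorem opStrandAOp_apply (a : Aᵐᵒᵖ) :
    opStrandAOp K A B a = 1 ⊗ₜ MulOpposite.op (a.unop ⊗ₜ 1) := rfl

theorem opStrandBOp_apply (b : Bᵐᵒᵖ) :
    opStrandBOp K A B b = 1 ⊗ₜ MulOpposite.op (1 ⊗ₜ b.unop) := rfl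

theorem commute_opStrandA_opStrandB (a : A) (b : B) :
    Commute (opStrandA K A B a) (opStrandB K A B b) := by
  simp [Commute, SemiconjBy, opStrandA_apply, opStrandB_apply]

theorem commute_opStrandA_opStrandAOp (a : A) (b : Aᵐᵒᵖ) :
    Commute (opStrandA K A B a) (opStrandAOp K A B b) := by
  simp [Commute, SemiconjBy, opStrandA_apply, opStrandAOp_apply]

theorem commute_opStrandA_opStrandBOp (a : A) (b : Bᵐᵒᵖ) :
    Commute (opStrandA K A B a) (opStrandBOp K A B b) := by
  simp [Commute, SemiconjBy, opStrandA_apply, opStrandBOp_apply]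

theorem commute_opStrandB_opStrandAOp (a : B) (b : Aᵐᵒᵖ) :
    Commute (opStrandB K A B a) (opStrandAOp K A B b) := by
  simp [Commute, SemiconjBy, opStrandB_apply, opStrandAOp_apply]

theorem commute_opStrandB_opStrandBOp (a : B) (b : Bᵐᵒᵖ) :
    Commute (opStrandB K A B a) (opStrandBOp K A B b) := by
  simp [Commute, SemiconjBy, opStrandB_apply, opStrandBOp_apply]

theorem commute_opStrandBOp_opStrandAOp (a : Bᵐᵒᵖ) (b : Aᵐᵒᵖ) :
    Commute (opStrandBOp K A B a) (opStrandAOp K A B b) := by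
  simp [Commute, SemiconjBy, opStrandBOp_apply, opStrandAOp_apply, ← MulOpposite.op_mul]

theorem opify_braid (p : A ⊗[K] A) (p' : B ⊗[K] B) (r s : A ⊗[K] B) :
    opify K (A ⊗[K] B) (A ⊗[K] B)
        (E14 K A B A B r * E13 K A B A B p * E24 K A B A B p' * E32 K A B A B s) =
      mulMap (opStrandB K A B) (opStrandBOp K A B) (opify K B B p') *
        mulMap (opStrandA K A B) (opStrandBOp K A B) (opify K A B r) *
        mulMap (opStrandB K A B) (opStrandAOp K A B)
          (opify K B A (TensorProduct.comm K A B s)) *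
        mulMap (opStrandA K A B) (opStrandAOp K A B) (opify K A A p) := by
  induction p with
  | zero => simp
  | add x y hx hy => simp only [map_add, mul_add, add_mul, hx, hy]
  | tmul p₁ p₂ =>
  induction p' with
  | zero => simp
  | add x y hx hy => simp only [map_add, mul_add, add_mul, hx, hy]
  | tmul p₃ p₄ =>
  induction r with
  | zero => simp
  | add x y hx hy => simp only [map_add, mul_add, add_mul, hx, hy]
  | tmul r₁ r₂ =>
  induction s with
  | zero => simp
  | add x y hx hy => simp only [map_add, mul_add, hx, hy, add_mul]
  | tmul s₁ s₂ =>
  simp [opify, E14, E13, E24, E32, E23, opStrandA_apply, opStrandB_apply, opStrandAOp_apply,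
    opStrandBOp_apply, ← MulOpposite.op_mul]

theorem opify_braid_inv (p : A ⊗[K] A) (p' : B ⊗[K] B) (r s : A ⊗[K] B) :
    opify K (A ⊗[K] B) (A ⊗[K] B)
        (E32 K A B A B r * E13 K A B A B p * E24 K A B A B p' * E14 K A B A B s) =
      mulMap (opStrandA K A B) (opStrandAOp K A B) (opify K A A p) *
        mulMap (opStrandB K A B) (opStrandAOp K A B)
          (opify K B A (TensorProduct.comm K A B r)) *
        mulMap (opStrandA K A B) (opStrandBOp K A B) (opify K A B s) *
        mulMap (opStrandB K A B) (opStrandBOp K A B) (opify K B B p') := by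
  induction p with
  | zero => simp
  | add x y hx hy => simp only [map_add, mul_add, add_mul, hx, hy]
  | tmul p₁ p₂ =>
  induction p' with
  | zero => simp
  | add x y hx hy => simp only [map_add, mul_add, add_mul, hx, hy]
  | tmul p₃ p₄ =>
  induction r with
  | zero => simp
  | add x y hx hy => simp only [map_add, mul_add, add_mul, hx, hy]
  | tmul r₁ r₂ =>
  induction s with
  | zero => simp
  | add x y hx hy => simp only [map_add, mul_add, hx, hy, add_mul]
  | tmul s₁ s₂ =>
  simp [opify, E14, E13, E24, E32, E23, opStrandA_apply, opStrandB_apply, opStrandAOp_apply,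
    opStrandBOp_apply, ← MulOpposite.op_mul]

theorem opify_braid_inv_mul_opify_braid {p q : A ⊗[K] A} {p' q' : B ⊗[K] B}
    {r s x y : A ⊗[K] B} (hp : opify K A A q * opify K A A p = 1)
    (hp' : opify K B B q' * opify K B B p' = 1) (hr : opify K A B s * opify K A B r = 1)
    (hx : opify K A B y * opify K A B x = 1) :
    opify K (A ⊗[K] B) (A ⊗[K] B)
        (E32 K A B A B x * E13 K A B A B q * E24 K A B A B q' * E14 K A B A B s) *
      opify K (A ⊗[K] B) (A ⊗[K] B)
        (E14 K A B A B r * E13 K A B A B p * E24 K A B A B p' * E32 K A B A B y) = 1 := by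
  have h₁ := mulMap_mul_eq_one (commute_opStrandA_opStrandAOp (K := K) (A := A) (B := B)) hp
  have h₂ := mulMap_mul_eq_one (commute_opStrandB_opStrandBOp (K := K) (A := A) (B := B)) hp'
  have h₃ := mulMap_mul_eq_one (commute_opStrandA_opStrandBOp (K := K) (A := A) (B := B)) hr
  have h₄ := mulMap_mul_eq_one (commute_opStrandB_opStrandAOp (K := K) (A := A) (B := B))
      (opify_comm_mul_eq_one hx)
  rw [opify_braid, opify_braid_inv]
  simp only [mul_assoc]
  rw [mul_cancel_left_of_eq_one h₂, mul_cancel_left_of_eq_one h₃, mul_cancel_left_of_eq_one h₄, h₁]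

theorem opify_braid_mul_opify_braid_inv {p q : A ⊗[K] A} {p' q' : B ⊗[K] B}
    {r s x y : A ⊗[K] B} (hp : opify K A A p * opify K A A q = 1)
    (hp' : opify K B B p' * opify K B B q' = 1) (hr : opify K A B r * opify K A B s = 1)
    (hx : opify K A B x * opify K A B y = 1) :
    opify K (A ⊗[K] B) (A ⊗[K] B)
        (E14 K A B A B r * E13 K A B A B p * E24 K A B A B p' * E32 K A B A B y) *
      opify K (A ⊗[K] B) (A ⊗[K] B)
        (E32 K A B A B x * E13 K A B A B q * E24 K A B A B q' * E14 K A B A B s) = 1 := by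
  have h₁ := mulMap_mul_eq_one (commute_opStrandA_opStrandAOp (K := K) (A := A) (B := B)) hp
  have h₂ := mulMap_mul_eq_one (commute_opStrandB_opStrandBOp (K := K) (A := A) (B := B)) hp'
  have h₃ := mulMap_mul_eq_one (commute_opStrandA_opStrandBOp (K := K) (A := A) (B := B)) hr
  have h₄ := mulMap_mul_eq_one (commute_opStrandB_opStrandAOp (K := K) (A := A) (B := B))
      (opify_comm_mul_eq_one hx)
  rw [opify_braid, opify_braid_inv]
  simp only [mul_assoc]
  rw [mul_cancel_left_of_eq_one h₁, mul_cancel_left_of_eq_one h₄, mul_cancel_left_of_eq_one h₃, h₂]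

end Opposite

section Maps

variable (f f' : A →ₐ[K] A) (g g' : B →ₐ[K] B)

theorem map_E13 (x : A ⊗[K] A) :
    Algebra.TensorProduct.map (Algebra.TensorProduct.map f g) (Algebra.TensorProduct.map f' g')
      (E13 K A B A B x) = E13 K A B A B (Algebra.TensorProduct.map f f' x) := by
  induction x with
  | zero => simp
  | tmul a b => simp [E13]
  | add x y hx hy => simp only [map_add, hx, hy]

theorem map_E14 (x : A ⊗[K] B) :
    Algebra.TensorProduct.map (Algebra.TensorProduct.map f g) (Algebra.TensorProduct.map f' g')
      (E14 K A B A B x) = E14 K A B A B (Algebra.TensorProduct.map f g' x) := by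
  induction x with
  | zero => simp
  | tmul a b => simp [E14]
  | add x y hx hy => simp only [map_add, hx, hy]

theorem map_E24 (x : B ⊗[K] B) :
    Algebra.TensorProduct.map (Algebra.TensorProduct.map f g) (Algebra.TensorProduct.map f' g')
      (E24 K A B A B x) = E24 K A B A B (Algebra.TensorProduct.map g g' x) := by
  induction x with
  | zero => simp
  | tmul a b => simp [E24]
  | add x y hx hy => simp only [map_add, hx, hy]

theorem map_E32 (x : A ⊗[K] B) :
    Algebra.TensorProduct.map (Algebra.TensorProduct.map f g) (Algebra.TensorProduct.map f' g')
      (E32 K A B A B x) = E32 K A B A B (Algebra.TensorProduct.map f' g x) := by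
  induction x with
  | zero => simp
  | tmul a b => simp [E32, E23]
  | add x y hx hy => simp only [map_add, hx, hy]

end Maps

theorem opify_map_left (f : A →ₐ[K] A) (x : A ⊗[K] B) :
    opify K A B (Algebra.TensorProduct.map f (AlgHom.id K B) x) =
      Algebra.TensorProduct.map f (AlgHom.id K Bᵐᵒᵖ) (opify K A B x) := by
  induction x with
  | zero => simp
  | tmul a b => simp [opify]
  | add x y hx hy => simp only [map_add, hx, hy]

section Twist

variable {r rinv : A ⊗[K] B} {σ τ : A ≃ₐ[K] A} {σ' τ' : B ≃ₐ[K] B}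

theorem map_twist_inv (x : A ⊗[K] B) :
    Algebra.TensorProduct.map (σ.symm.trans τ).toAlgHom (AlgHom.id K B)
        (Algebra.TensorProduct.map σ.toAlgHom (AlgHom.id K B) x) =
      Algebra.TensorProduct.map τ.toAlgHom (AlgHom.id K B) x := by
  induction x with
  | zero => simp
  | tmul a b => simp
  | add x y hx hy => simp only [map_add, hx, hy]

theorem map_twist (hc : ∀ a, σ (τ a) = τ (σ a))
    (hσ : Algebra.TensorProduct.map σ.toAlgHom σ'.toAlgHom r = r)
    (hτ : Algebra.TensorProduct.map τ.toAlgHom τ'.toAlgHom r = r) :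
    Algebra.TensorProduct.map (σ.symm.trans τ).toAlgHom (AlgHom.id K B)
        (Algebra.TensorProduct.map (AlgHom.id K A) τ'.toAlgHom r) =
      Algebra.TensorProduct.map (AlgHom.id K A) σ'.toAlgHom r := by
  have h₁ : ∀ x : A ⊗[K] B,
      Algebra.TensorProduct.map (σ.symm.trans τ).toAlgHom (AlgHom.id K B)
        (Algebra.TensorProduct.map (AlgHom.id K A) τ'.toAlgHom x) =
      Algebra.TensorProduct.map σ.symm.toAlgHom (AlgHom.id K B)
        (Algebra.TensorProduct.map τ.toAlgHom τ'.toAlgHom x) := fun x => by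
    induction x with
    | zero => simp
    | tmul a b =>
      have : τ (σ.symm a) = σ.symm (τ a) := by
        rw [AlgEquiv.eq_symm_apply, hc, AlgEquiv.apply_symm_apply]
      simp [this]
    | add x y hx hy => simp only [map_add, hx, hy]
  have h₂ : ∀ x : A ⊗[K] B,
      Algebra.TensorProduct.map σ.symm.toAlgHom (AlgHom.id K B)
        (Algebra.TensorProduct.map σ.toAlgHom σ'.toAlgHom x) =
      Algebra.TensorProduct.map (AlgHom.id K A) σ'.toAlgHom x := fun x => by
    induction x with
    | zero => simp
    | tmul a b => simp
    | add x y hx hy => simp only [map_add, hx, hy]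
  rw [h₁, hτ, ← h₂, hσ]

end Twist

section TripleTensor

variable (K) (H : Type*) [Ring H] [Algebra K H]

/-- The inclusion of `H` as one of the three factors of `H ⊗ (H ⊗ H)`. -/
def tripleIncl : Fin 3 → H →ₐ[K] H ⊗[K] (H ⊗[K] H) :=
  ![Algebra.TensorProduct.includeLeft,
    Algebra.TensorProduct.includeRight.comp Algebra.TensorProduct.includeLeft,
    Algebra.TensorProduct.includeRight.comp Algebra.TensorProduct.includeRight]

theorem commute_tripleIncl {s t : Fin 3} (h : s ≠ t) (a b : H) :
    Commute (tripleIncl K H s a) (tripleIncl K H t b) := by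
  fin_cases s <;> fin_cases t <;> simp_all [tripleIncl, Commute, SemiconjBy]

end TripleTensor

end OQApaper

open OQApaper

/-- Theorem 3.6: an OQA nonuple gives an OQA structure
`α̃ = r_k pᵢ ⊗ p'ⱼ R^n ⊗ pⁱ R_n ⊗ r^k p'ʲ` on `H ⊗ H'` with the stated inverse. -/
theorem oqa_from_nonuple (K : Type*) [Field K] (A B : Type*) [Ring A] [Ring B]
    [Algebra K A] [Algebra K B]
    (p pinv : A ⊗[K] A) (p' p'inv : B ⊗[K] B) (r rinv : A ⊗[K] B)
    (σ τ : A ≃ₐ[K] A) (σ' τ' : B ≃ₐ[K] B)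
    (hp : IsOQA K p pinv σ τ) (hp' : IsOQA K p' p'inv σ' τ')
    (hn : IsOQANonuple K p pinv p' p'inv r rinv σ τ σ' τ') :
    IsOQA K
      (E14 K A B A B r * E13 K A B A B p * E24 K A B A B p' * E32 K A B A B rinv)
      (E32 K A B A B r * E13 K A B A B pinv * E24 K A B A B p'inv * E14 K A B A B rinv)
      (Algebra.TensorProduct.congr σ σ') (Algebra.TensorProduct.congr τ τ') := by
  have hpp' : ∀ x y, Commute (E13 K A B A B x) (E24 K A B A B y) := fun x y => by
    induction x with
    | zero => simp
    | add x y hx hy => rw [map_add]; exact hx.add_left hy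
    | tmul a b =>
      induction y with
      | zero => simp
      | add x y hx hy => rw [map_add]; exact hx.add_right hy
      | tmul c d => simp [E13, E24, Commute, SemiconjBy]
  have map_rinv {f : A ⊗[K] B →ₐ[K] A ⊗[K] B} (h : f r = r) : f rinv = rinv := by
    have := algHom_mul_eq_one f hn.r_inv_mul
    rw [h] at this
    exact left_inv_eq_right_inv this hn.r_mul_inv
  have congr_eq (f : A ≃ₐ[K] A) (g : B ≃ₐ[K] B) :
      (Algebra.TensorProduct.congr f g).toAlgHom =
        Algebra.TensorProduct.map f.toAlgHom g.toAlgHom := rfl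
  have id_eq : AlgHom.id K (A ⊗[K] B) =
      Algebra.TensorProduct.map (AlgHom.id K A) (AlgHom.id K B) :=
    Algebra.TensorProduct.map_id.symm
  refine ⟨fun a => ?_, ?_, ?_, ?_, ?_, ?_, ?_, ?_⟩
  · induction a with
    | zero => simp
    | tmul a b => simp [hn.comm_auto, hn.comm_auto']
    | add x y hx hy => simp only [map_add, hx, hy]
  · simp only [mul_assoc]
    rw [mul_cancel_left_of_eq_one (algHom_mul_eq_one _ hn.r_inv_mul),
      ← mul_assoc (E24 _ _ _ _ _ p'),
      ← (hpp' pinv p').eq, mul_assoc,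
      mul_cancel_left_of_eq_one (algHom_mul_eq_one _ hn.p_mul_inv),
      mul_cancel_left_of_eq_one (algHom_mul_eq_one _ hn.p'_mul_inv),
      algHom_mul_eq_one _ hn.r_mul_inv]
  · simp only [mul_assoc]
    rw [mul_cancel_left_of_eq_one (algHom_mul_eq_one _ hn.r_inv_mul),
      ← mul_assoc (E24 _ _ _ _ _ p'inv),
      ← (hpp' p p'inv).eq, mul_assoc,
      mul_cancel_left_of_eq_one (algHom_mul_eq_one _ hn.p_inv_mul),
      mul_cancel_left_of_eq_one (algHom_mul_eq_one _ hn.p'_inv_mul),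
      algHom_mul_eq_one _ hn.r_mul_inv]
  · rw [congr_eq, congr_eq, id_eq]
    simp only [map_mul, map_E13, map_E14, map_E24, map_E32]
    refine opify_braid_inv_mul_opify_braid hp.op_mul_inv hp'.op_mul_inv hn.op_mul_inv ?_
    rw [← map_twist hn.comm_auto hn.map_sigma hn.map_tau,
      ← map_twist_inv (σ := σ) (τ := τ) rinv, opify_map_left,
      opify_map_left _ (Algebra.TensorProduct.map (AlgHom.id K A) τ'.toAlgHom r)]
    exact algHom_mul_eq_one _ hn.op_mul_inv
  · rw [congr_eq, congr_eq, id_eq]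
    simp only [map_mul, map_E13, map_E14, map_E24, map_E32]
    refine opify_braid_mul_opify_braid_inv hp.op_inv_mul hp'.op_inv_mul hn.op_inv_mul ?_
    rw [← map_twist hn.comm_auto hn.map_sigma hn.map_tau,
      ← map_twist_inv (σ := σ) (τ := τ) rinv, opify_map_left,
      opify_map_left _ (Algebra.TensorProduct.map σ.toAlgHom (AlgHom.id K B) rinv)]
    exact algHom_mul_eq_one _ hn.op_inv_mul
  · simp only [congr_eq, map_mul, map_E13, map_E14, map_E24, map_E32, hp.map_sigma,
      hp'.map_sigma, hn.map_sigma, map_rinv hn.map_sigma]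
  · simp only [congr_eq, map_mul, map_E13, map_E14, map_E24, map_E32, hp.map_tau,
      hp'.map_tau, hn.map_tau, map_rinv hn.map_tau]
  · let i s := (tripleIncl K (A ⊗[K] B) s).comp
      (Algebra.TensorProduct.includeLeft : A →ₐ[K] A ⊗[K] B)
    let j s := (tripleIncl K (A ⊗[K] B) s).comp
      (Algebra.TensorProduct.includeRight : B →ₐ[K] A ⊗[K] B)
    have key := fusedBraid_yang_baxter hn.r_mul_inv hn.r_inv_mul hp.qybe hp'.qybe hn.cond3
      hn.cond4 i j (fun s t h a b => commute_tripleIncl K _ h _ _)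
      (fun s t h a b => commute_tripleIncl K _ h _ _) (fun s t a b => ?_)
    · rw [map_fusedBraid (emb12 K _ _ _) (i := i 0) (j := j 0) (i' := i 1) (j' := j 1),
        map_fusedBraid (emb13 K _ _ _) (i := i 0) (j := j 0) (i' := i 2) (j' := j 2),
        map_fusedBraid (emb23 K _ _ _) (i := i 1) (j := j 1) (i' := i 2) (j' := j 2), key]
      all_goals
        intro x
        simp [emb12, emb13, emb23, i, j, tripleIncl, Algebra.TensorProduct.one_def]
    · rcases eq_or_ne s t with rfl | h
      · refine Commute.map ?_ (tripleIncl K (A ⊗[K] B) s)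
        simp [Commute, SemiconjBy]
      · exact commute_tripleIncl K _ h _ _
end
end
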